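/- Fix a band-limit n_max and integers μ, m with |μ|, |m| ≤ n_max, and set n₀ = max(|μ|, |m|). Let C' > 0 be a constant such that each Wigner D-function with band-limit n_max satisfies sup_{(α,β,γ)} |√(sin β) · D_n^{μm}(α,β,γ)| ≤ C' N_D^{1/12}, where N_D = (n_max+1)(2n_max+1)(2n_max+3)/3. Let c ∈ ℂ^{n_max − n₀ + 1} with ∑_{n=n₀}^{n_max} |c_n|² = 1 and define g(α,β,γ) = ∑_{n=n₀}^{n_max} c_n D_n^{μm}(α,β,γ). Then for any λ with 0 < λ_min ≤ λ ≤ 1, sup_{(α,β,γ)} |√(sin β / λ) · g(α,β,γ)| ≤ (3/2)^{1/6} C' N_D^{1/4} / √(λ_min). In particular every Rotation Group Slepian Function with concentration at least λ_min, normalized to unit energy on the belt R, obeys this uniform bound. -/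

import Mathlib

open scoped Real

/-- The Wigner d-function d_n^{μm}(β). -/
noncomputable def wignerd (n : ℕ) (μ m : ℤ) (β : ℝ) : ℝ :=
  (-1 : ℝ) ^ (μ - m) * Real.sqrt ((2 * (n : ℝ) + 1) / 2) *
    Real.sqrt ((((n : ℤ) + m).toNat.factorial * ((n : ℤ) - m).toNat.factorial *
      ((n : ℤ) + μ).toNat.factorial * ((n : ℤ) - μ).toNat.factorial : ℕ) : ℝ) *
    ∑ σ ∈ Finset.Icc (max 0 (m - μ)) (min ((n : ℤ) + m) ((n : ℤ) - μ)),
      ((-1 : ℝ) ^ σ * Real.cos (β / 2) ^ (2 * (n : ℤ) - 2 * σ + m - μ) *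
        Real.sin (β / 2) ^ (2 * σ - m + μ)) /
      ((σ.toNat.factorial * ((n : ℤ) + m - σ).toNat.factorial *
        ((n : ℤ) - μ - σ).toNat.factorial * (μ - m + σ).toNat.factorial : ℕ) : ℝ)

/-- The Wigner D-function D_n^{μm}(α,β,γ) = (4π²)^{−1/2} e^{−iμα} d_n^{μm}(β) e^{−imγ}. -/
noncomputable def WignerD (n : ℕ) (μ m : ℤ) (α β γ : ℝ) : ℂ :=
  ((Real.sqrt (4 * π ^ 2))⁻¹ : ℝ) * Complex.exp (-Complex.I * (μ : ℂ) * (α : ℂ)) *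
    ((wignerd n μ m β : ℝ) : ℂ) * Complex.exp (-Complex.I * (m : ℂ) * (γ : ℂ))

/-- Cauchy–Schwarz for a linear combination of uniformly bounded vectors. -/
theorem norm_sum_mul_le_sqrt_card_mul {ι : Type*} (s : Finset ι) (c f : ι → ℂ) {B : ℝ}
    (hB : 0 ≤ B) (hc : ∑ i ∈ s, ‖c i‖ ^ 2 = 1) (hf : ∀ i ∈ s, ‖f i‖ ≤ B) :
    ‖∑ i ∈ s, c i * f i‖ ≤ Real.sqrt s.card * B := by
  calc ‖∑ i ∈ s, c i * f i‖ ≤ ∑ i ∈ s, ‖c i‖ * ‖f i‖ := by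
        simpa only [norm_mul] using norm_sum_le s fun i => c i * f i
    _ ≤ ∑ i ∈ s, ‖c i‖ * B :=
        Finset.sum_le_sum fun i hi => mul_le_mul_of_nonneg_left (hf i hi) (norm_nonneg _)
    _ = (∑ i ∈ s, ‖c i‖) * B := (Finset.sum_mul ..).symm
    _ ≤ Real.sqrt s.card * B := by
        refine mul_le_mul_of_nonneg_right (Real.le_sqrt_of_sq_le ?_) hB
        simpa [hc] using sq_sum_le_card_mul_sum_sq (s := s) (f := fun i => ‖c i‖)

/-- If `K ≤ n + 1`, then `√K` is at most the sixth root of `(n + 1)(2n + 1)(2n + 3) / 2`. -/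
theorem sqrt_le_three_halves_mul_rpow (n K : ℝ) (hn : 0 ≤ n) (hK : 0 ≤ K) (hKn : K ≤ n + 1) :
    Real.sqrt K ≤ (3 / 2 : ℝ) ^ ((1 : ℝ) / 6) *
      ((n + 1) * (2 * n + 1) * (2 * n + 3) / 3) ^ ((1 : ℝ) / 6) := by
  rw [← Real.mul_rpow (by norm_num) (by positivity)]
  have hcube : K ^ 3 ≤ 3 / 2 * ((n + 1) * (2 * n + 1) * (2 * n + 3) / 3) := by
    have : K ^ 3 ≤ (n + 1) ^ 3 := pow_le_pow_left₀ hK hKn 3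
    nlinarith [pow_nonneg hn 2, pow_nonneg hn 3]
  calc Real.sqrt K = (K ^ 3) ^ ((1 : ℝ) / 6) := by
        rw [Real.sqrt_eq_rpow, ← Real.rpow_natCast, ← Real.rpow_mul hK]
        norm_num
    _ ≤ _ := Real.rpow_le_rpow (by positivity) hcube (by norm_num)

/-- Proposition 1, uniform bound on RGSFs: if every Wigner
D-function in the fixed-(m,μ) subspace with n₀ = max(|μ|,|m|) ≤ n ≤ n_max obeys
sup |√(sin β)·D_n^{μm}| ≤ C' N_D^{1/12}, then any unit-energy combination g of
them, renormalized by a concentration λ ≥ λ_min > 0, obeys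
sup |√(sin β/λ)·g| ≤ (3/2)^{1/6} C' N_D^{1/4} / √λ_min. -/
theorem rgsf_uniform_bound
    (n_max : ℕ) (μ m : ℤ) (hμ : |μ| ≤ (n_max : ℤ)) (hm : |m| ≤ (n_max : ℤ))
    (n₀ : ℕ) (hn₀ : (n₀ : ℤ) = max |μ| |m|)
    (N_D : ℝ) (hND : N_D = ((n_max : ℝ) + 1) * (2 * n_max + 1) * (2 * n_max + 3) / 3)
    (C' : ℝ) (hC' : 0 < C')
    (hbound : ∀ n : ℕ, n₀ ≤ n → n ≤ n_max → ∀ α β γ : ℝ, β ∈ Set.Icc (0 : ℝ) π →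
      ‖((Real.sqrt (Real.sin β) : ℝ) : ℂ) * WignerD n μ m α β γ‖ ≤ C' * N_D ^ ((1 : ℝ) / 12))
    (c : ℕ → ℂ) (hc : ∑ n ∈ Finset.Icc n₀ n_max, ‖c n‖ ^ 2 = 1)
    (g : ℝ → ℝ → ℝ → ℂ)
    (hg : ∀ α β γ : ℝ, g α β γ = ∑ n ∈ Finset.Icc n₀ n_max, c n * WignerD n μ m α β γ)
    (lam lammin : ℝ) (hlammin : 0 < lammin) (hlow : lammin ≤ lam) (hhigh : lam ≤ 1) :
    ∀ α β γ : ℝ, β ∈ Set.Icc (0 : ℝ) π →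
      ‖((Real.sqrt (Real.sin β / lam) : ℝ) : ℂ) * g α β γ‖
        ≤ (3 / 2 : ℝ) ^ ((1 : ℝ) / 6) * C' * N_D ^ ((1 : ℝ) / 4) / Real.sqrt lammin := by
  intro α β γ hβ
  have hN : 0 < N_D := by rw [hND]; positivity
  have hlam : 0 < lam := hlammin.trans_le hlow
  have hcard : ((Finset.Icc n₀ n_max).card : ℝ) ≤ (n_max : ℝ) + 1 := by
    rw [Nat.card_Icc]
    exact_mod_cast Nat.sub_le _ _
  have hsqrt : Real.sqrt (Finset.Icc n₀ n_max).card ≤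
      (3 / 2 : ℝ) ^ ((1 : ℝ) / 6) * N_D ^ ((1 : ℝ) / 6) := by
    rw [hND]
    exact sqrt_le_three_halves_mul_rpow _ _ n_max.cast_nonneg (Nat.cast_nonneg _) hcard
  have hsum : ‖((Real.sqrt (Real.sin β) : ℝ) : ℂ) * g α β γ‖ ≤
      (3 / 2 : ℝ) ^ ((1 : ℝ) / 6) * C' * N_D ^ ((1 : ℝ) / 4) := by
    have hcomb : ((Real.sqrt (Real.sin β) : ℝ) : ℂ) * g α β γ = ∑ n ∈ Finset.Icc n₀ n_max,
        c n * (((Real.sqrt (Real.sin β) : ℝ) : ℂ) * WignerD n μ m α β γ) := by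
      rw [hg, Finset.mul_sum]
      exact Finset.sum_congr rfl fun n _ => mul_left_comm _ _ _
    have hpow : N_D ^ ((1 : ℝ) / 6) * N_D ^ ((1 : ℝ) / 12) = N_D ^ ((1 : ℝ) / 4) := by
      rw [← Real.rpow_add hN]
      norm_num
    calc ‖((Real.sqrt (Real.sin β) : ℝ) : ℂ) * g α β γ‖
        ≤ Real.sqrt (Finset.Icc n₀ n_max).card * (C' * N_D ^ ((1 : ℝ) / 12)) := by
          rw [hcomb]
          refine norm_sum_mul_le_sqrt_card_mul _ c _ (by positivity) hc fun n hn => ?_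
          obtain ⟨hlo, hhi⟩ := Finset.mem_Icc.mp hn
          exact hbound n hlo hhi α β γ hβ
      _ ≤ (3 / 2 : ℝ) ^ ((1 : ℝ) / 6) * N_D ^ ((1 : ℝ) / 6) * (C' * N_D ^ ((1 : ℝ) / 12)) :=
          mul_le_mul_of_nonneg_right hsqrt (by positivity)
      _ = (3 / 2 : ℝ) ^ ((1 : ℝ) / 6) * C' * N_D ^ ((1 : ℝ) / 4) := by
          rw [← hpow]
          ring
  have hdiv : ‖((Real.sqrt (Real.sin β / lam) : ℝ) : ℂ) * g α β γ‖ =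
      ‖((Real.sqrt (Real.sin β) : ℝ) : ℂ) * g α β γ‖ / Real.sqrt lam := by
    rw [Real.sqrt_div' _ hlam.le, norm_mul, norm_mul, Complex.norm_real, Complex.norm_real,
      norm_div, Real.norm_of_nonneg (Real.sqrt_nonneg lam), div_mul_eq_mul_div]
  rw [hdiv]
  exact div_le_div₀ (by positivity) hsum (Real.sqrt_pos.mpr hlammin) (Real.sqrt_le_sqrt hlow)
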